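/- arXiv:1912.06909 — 3 statements merged into one kernel-verified Lean document; each statement's English description precedes it below -/
import Mathlib

section
/- For every preference profile P that is single-peaked with respect to ≺ and every endowment profile ω, the ascending crawler and the descending crawler select the same allocation: ACR(P,ω) = DCR(P,ω). -/
/- Preferences are given by rank functions: `rk i o` is agent `i`'s rank of object `o`
(lower rank = more preferred), so `o P_i o'` iff `rk i o < rk i o'`. -/

/-- Find the smallest index `t` such that the `t`-th agent prefers the `t`-th object
to the `(t+1)`-st object; the last index always qualifies. -/
def findIdx2 {n : ℕ} (rk : Fin n → Fin n → Fin n) : List (Fin n) → List (Fin n) → ℕ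
  | a :: as, o1 :: o2 :: os =>
      if rk a o1 < rk a o2 then 0 else findIdx2 rk as (o2 :: os) + 1
  | _, _ => 0

/-- One run of the (ascending) crawler: `agents` is the list of remaining agents in the
order of their current ownership, `objects` the list of remaining objects in increasing
`≺`-order (the `t`-th agent currently owns the `t`-th object). -/
def crawlAux {n : ℕ} (rk : Fin n → Fin n → Fin n) :
    ℕ → List (Fin n) → List (Fin n) → List (Fin n × Fin n)
  | 0, _, _ => []
  | fuel + 1, agents, objects =>
    match agents, objects with
    | a0 :: _, o0 :: _ =>
      let t := findIdx2 rk agents objects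
      let a := agents.getD t a0
      let ostar := (objects.argmin (rk a)).getD o0
      (a, ostar) :: crawlAux rk fuel (agents.eraseIdx t) (objects.erase ostar)
    | _, _ => []

/-- Agents listed in increasing order of their endowments. -/
def ownersList {n : ℕ} (ω : Fin n → Fin n) : List (Fin n) :=
  (List.finRange n).filterMap fun o => (List.finRange n).find? fun a => ω a == o

/-- The (ascending) crawler allocation. -/
def CRfun {n : ℕ} (rk : Fin n → Fin n → Fin n) (ω : Fin n → Fin n) (i : Fin n) : Fin n :=
  ((crawlAux rk n (ownersList ω) (List.finRange n)).lookup i).getD (ω i)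

/-- The descending crawler: the mirror image of the ascending crawler, obtained by
reversing the order `≺` on objects. -/
def DCRfun {n : ℕ} (rk : Fin n → Fin n → Fin n) (ω : Fin n → Fin n) (i : Fin n) : Fin n :=
  Fin.rev (CRfun (fun j o => rk j o.rev) (fun j => (ω j).rev) i)

/-- Sequential priority: agents in the given list pick, in order, their most
preferred remaining object. -/
def SPAux {n : ℕ} (rk : Fin n → Fin n → Fin n) :
    List (Fin n) → List (Fin n) → List (Fin n × Fin n)
  | [], _ => []
  | _ :: _, [] => []
  | a :: as, o0 :: os =>
      let o := ((o0 :: os).argmin (rk a)).getD o0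
      (a, o) :: SPAux rk as ((o0 :: os).erase o)

/-- The sequential priority rule induced by the order `f` (agent `f k` has priority `k`). -/
def SPfun {n : ℕ} (rk : Fin n → Fin n → Fin n) (f : Fin n → Fin n) (i : Fin n) : Fin n :=
  ((SPAux rk ((List.finRange n).map f) (List.finRange n)).lookup i).getD i

/-- Top trading cycles: `own` maps each remaining object to its (initial) owner. -/
def TTCAux {n : ℕ} (rk : Fin n → Fin n → Fin n) :
    ℕ → List (Fin n) → List (Fin n) → (Fin n → Fin n) → List (Fin n × Fin n)
  | 0, _, _, _ => []
  | fuel + 1, agents, objects, own =>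
    match agents with
    | [] => []
    | a0 :: _ =>
      let top : Fin n → Fin n := fun a => (objects.argmin (rk a)).getD a0
      let ptr : Fin n → Fin n := fun a => own (top a)
      let onCyc : Fin n → Bool := fun a =>
        (List.range agents.length).any fun k => ptr^[k + 1] a == a
      let cyc := agents.filter onCyc
      let assigned := cyc.map top
      (cyc.map fun a => (a, top a)) ++
        TTCAux rk fuel (agents.filter fun a => !onCyc a)
          (objects.filter fun o => !(assigned.contains o)) own

/-- The top trading cycles allocation from endowments `ω`. -/
def TTCfun {n : ℕ} (rk : Fin n → Fin n → Fin n) (ω : Equiv.Perm (Fin n)) (i : Fin n) : Fin n :=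
  ((TTCAux rk n (List.finRange n) (List.finRange n) ω.symm).lookup i).getD (ω i)

/-- A profile of strict preferences (given as rank permutations) is single-peaked
with respect to the order on `Fin n`. -/
def SinglePeaked {n : ℕ} (P : Fin n → Equiv.Perm (Fin n)) : Prop :=
  ∀ i : Fin n, ∃ p : Fin n, ∀ o o' : Fin n,
    ((o' < o ∧ o ≤ p) ∨ (p ≤ o ∧ o < o')) → P i o < P i o'

/-- Pareto efficiency of an allocation `x` at the profile `P`. -/
def ParetoEfficient {n : ℕ} (P : Fin n → Equiv.Perm (Fin n)) (x : Fin n → Fin n) : Prop :=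
  ¬ ∃ y : Equiv.Perm (Fin n),
      (∀ i, P i (y i) ≤ P i (x i)) ∧ ∃ j, P j (y j) < P j (x j)

section Crawler

variable {n : ℕ}

/-- The number of elements of `S` placed strictly before `x` by the position function `f`. -/
def posRank (f : Fin n → Fin n) (S : Finset (Fin n)) (x : Fin n) : ℕ :=
  (S.filter fun y => f y < f x).card

/-- `o` is a best object of `O` for the rank function `r`. -/
def IsBest (r : Fin n → Fin n) (O : Finset (Fin n)) (o : Fin n) : Prop :=
  o ∈ O ∧ ∀ o' ∈ O, r o ≤ r o'

/-- No object is ranked below two others lying on both sides of it, for the order on objects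
given by the positions `q`. -/
def NoInteriorWorst (rk : Fin n → Fin n → Fin n) (q : Fin n → Fin n) : Prop :=
  ∀ i x y z, q x < q y → q y < q z → rk i y < rk i x ∨ rk i y < rk i z

/-- One step of the crawler with remaining agents `S`, ordered by `ω`, and remaining objects `O`,
ordered by `q`: agent `a` is the first one whose best object is not after his own. -/
structure CrawlStep (rk : Fin n → Fin n → Fin n) (ω q : Fin n → Fin n)
    (S O : Finset (Fin n)) (a o : Fin n) : Prop where
  mem : a ∈ S
  best : IsBest (rk a) O o
  le : posRank q O o ≤ posRank ω S a
  lt : ∀ c ∈ S, ω c < ω a → ∀ t, IsBest (rk c) O t → posRank ω S c < posRank q O t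

/-- The allocation `x` results from running the crawler on the agents `S` and objects `O`. -/
inductive CrawlRun (rk : Fin n → Fin n → Fin n) (ω q : Fin n → Fin n) :
    Finset (Fin n) → Finset (Fin n) → (Fin n → Fin n) → Prop
  | nil (x : Fin n → Fin n) : CrawlRun rk ω q ∅ ∅ x
  | cons {S O : Finset (Fin n)} {x : Fin n → Fin n} {a : Fin n}
      (h : CrawlStep rk ω q S O a (x a))
      (t : CrawlRun rk ω q (S.erase a) (O.erase (x a)) x) : CrawlRun rk ω q S O x

section PosRank

variable {f : Fin n → Fin n} {S : Finset (Fin n)} {x y : Fin n}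

theorem posRank_lt_posRank (hx : x ∈ S) (h : f x < f y) : posRank f S x < posRank f S y := by
  refine Finset.card_lt_card ⟨fun z hz => ?_, fun hs => ?_⟩
  · simp only [Finset.mem_filter] at hz ⊢
    exact ⟨hz.1, hz.2.trans h⟩
  · have := hs (Finset.mem_filter.2 ⟨hx, h⟩)
    simp at this

theorem posRank_lt_iff (hf : f.Injective) (hx : x ∈ S) (hy : y ∈ S) :
    posRank f S x < posRank f S y ↔ f x < f y := by
  refine ⟨fun h => ?_, posRank_lt_posRank hx⟩
  rcases lt_trichotomy (f x) (f y) with h' | h' | h'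
  · exact h'
  · simp [hf h'] at h
  · exact absurd (posRank_lt_posRank hy h') h.not_gt

theorem posRank_erase_of_le (h : f x ≤ f y) : posRank f (S.erase y) x = posRank f S x := by
  unfold posRank
  rw [Finset.filter_erase, Finset.erase_eq_of_notMem]
  simp [h]

theorem posRank_erase_of_lt (hy : y ∈ S) (h : f y < f x) :
    posRank f (S.erase y) x + 1 = posRank f S x := by
  unfold posRank
  rw [Finset.filter_erase, Finset.card_erase_add_one]
  simp [h, hy]

theorem posRank_add_posRank_rev (hf : f.Injective) (hx : x ∈ S) :
    posRank f S x + posRank (fun y => (f y).rev) S x + 1 = S.card := by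
  have h : S.filter (fun y => ¬ f y < f x) =
      insert x (S.filter fun y => (f y).rev < (f x).rev) := by
    ext z
    simp only [Finset.mem_filter, Finset.mem_insert, not_lt, Fin.rev_lt_rev, le_iff_eq_or_lt,
      hf.eq_iff]
    grind
  rw [← Finset.card_filter_add_card_filter_not (s := S) (fun y => f y < f x), h,
    Finset.card_insert_of_notMem (by simp)]
  rfl

theorem exists_between_of_posRank (hf : f.Injective) (h : posRank f S x + 1 < posRank f S y) :
    ∃ z ∈ S, f x < f z ∧ f z < f y := by
  by_contra! hc
  have hs : S.filter (fun z => f z < f y) ⊆ insert x (S.filter fun z => f z < f x) := by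
    intro z hz
    simp only [Finset.mem_filter, Finset.mem_insert] at hz ⊢
    rcases lt_trichotomy (f z) (f x) with h' | h' | h'
    · exact .inr ⟨hz.1, h'⟩
    · exact .inl (hf h')
    · exact absurd hz.2 (hc z hz.1 h').not_gt
  have := (Finset.card_le_card hs).trans (Finset.card_insert_le _ _)
  unfold posRank at h
  omega

end PosRank

variable {rk : Fin n → Fin n → Fin n} {ω q : Fin n → Fin n} {S O : Finset (Fin n)}

theorem NoInteriorWorst.rev (h : NoInteriorWorst rk q) :
    NoInteriorWorst rk fun x => (q x).rev := fun i x y z hxy hyz =>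
  (h i z y x (Fin.rev_lt_rev.1 hyz) (Fin.rev_lt_rev.1 hxy)).symm

theorem IsBest.eq {r : Fin n → Fin n} (hr : r.Injective) {o o' : Fin n} (h : IsBest r O o)
    (h' : IsBest r O o') : o = o' :=
  hr (le_antisymm (h.2 _ h'.1) (h'.2 _ h.1))

theorem IsBest.erase {r : Fin n → Fin n} {o o' : Fin n} (h : IsBest r O o) (hne : o ≠ o') :
    IsBest r (O.erase o') o :=
  ⟨Finset.mem_erase.2 ⟨hne, h.1⟩, fun z hz => h.2 z (Finset.mem_of_mem_erase hz)⟩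

/-- Once an object `o'` is removed, the new best object either was already best, or is not more
than one place before `o'`, which was best. -/
theorem IsBest.of_erase (hsp : NoInteriorWorst rk q) (hq : q.Injective) {i t o' : Fin n}
    (h : IsBest (rk i) (O.erase o') t) :
    IsBest (rk i) O t ∨ IsBest (rk i) O o' ∧ posRank q O o' ≤ posRank q O t + 1 := by
  obtain ⟨ht, hmin⟩ := h
  have htO := Finset.mem_of_mem_erase ht
  by_cases ho : IsBest (rk i) O t
  · exact .inl ho
  have hlt : o' ∈ O ∧ rk i o' < rk i t := by
    unfold IsBest at ho
    push Not at ho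
    obtain ⟨z, hz, hzt⟩ := ho htO
    by_cases hzo : z = o'
    · exact hzo ▸ ⟨hz, hzt⟩
    · exact absurd (hmin z (Finset.mem_erase.2 ⟨hzo, hz⟩)) hzt.not_ge
  refine .inr ⟨⟨hlt.1, fun z hz => ?_⟩, ?_⟩
  · by_cases hzo : z = o'
    · rw [hzo]
    · exact hlt.2.le.trans (hmin z (Finset.mem_erase.2 ⟨hzo, hz⟩))
  · by_contra! hc
    obtain ⟨z, hz, h1, h2⟩ := exists_between_of_posRank hq hc
    have := hmin z (Finset.mem_erase.2 ⟨fun e => by simp [e] at h2, hz⟩)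
    rcases hsp i t z o' h1 h2 with h3 | h3 <;> grind

/-- The first step of the crawler remains its first step after a first step of the mirror
crawler that concerns another agent; the two steps assign different objects. -/
theorem CrawlStep.erase_of_rev (hsp : NoInteriorWorst rk q) (hω : ω.Injective)
    (hq : q.Injective) (hcard : S.card = O.card) {a b o o' : Fin n} (hab : a ≠ b)
    (ha : CrawlStep rk ω q S O a o)
    (hb : CrawlStep rk (fun i => (ω i).rev) (fun i => (q i).rev) S O b o') :
    o ≠ o' ∧ CrawlStep rk ω q (S.erase b) (O.erase o') a o := by
  have hS : ∀ c ∈ S, _ := fun c hc => posRank_add_posRank_rev hω hc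
  have hO : ∀ c ∈ O, _ := fun c hc => posRank_add_posRank_rev hq hc
  have hale := ha.le
  have hble : posRank ω S b ≤ posRank q O o' := by
    have := hb.le
    have := hS b hb.mem
    have := hO o' hb.best.1
    omega
  have hblt : ∀ c ∈ S, ω b < ω c → ∀ t, IsBest (rk c) O t → posRank q O t < posRank ω S c := by
    intro c hc hbc t ht
    have := hb.lt c hc (Fin.rev_lt_rev.2 hbc) t ht
    have := hS c hc
    have := hO t ht.1
    omega
  have hsep : posRank q O o < posRank q O o' ∧
      (∀ c ∈ S, ω c < ω a → c ≠ b → ω c < ω b ∧ posRank ω S c + 1 < posRank q O o') ∧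
      posRank q O o ≤ posRank ω (S.erase b) a := by
    rcases lt_or_gt_of_ne (hω.ne hab) with h | h
    · have := posRank_lt_posRank ha.mem h
      refine ⟨by omega, fun c hc hca _ => ⟨hca.trans h, ?_⟩, ?_⟩
      · have := posRank_lt_posRank hc hca
        omega
      · rwa [posRank_erase_of_le h.le]
    · have h1 := posRank_lt_posRank hb.mem h
      have h2 := hblt a ha.mem h o ha.best
      have h3 := ha.lt b hb.mem h o' hb.best
      have h4 := posRank_erase_of_lt hb.mem h
      have h5 : ∀ c ∈ S, ω b < ω c → ¬ ω c < ω a := by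
        intro c hc hbc hca
        obtain ⟨t, ht, hmin⟩ := O.exists_min_image (rk c) ⟨o, ha.best.1⟩
        have := ha.lt c hc hca t ⟨ht, hmin⟩
        have := hblt c hc hbc t ⟨ht, hmin⟩
        omega
      have h6 : posRank ω S a ≤ posRank ω S b + 1 := by
        by_contra! hc
        obtain ⟨c, hc, h7, h8⟩ := exists_between_of_posRank hω hc
        exact h5 c hc h7 h8
      refine ⟨by omega, fun c hc hca hcb => ?_, by omega⟩
      have h7 : ω c < ω b := lt_of_le_of_ne (not_lt.1 fun h => h5 c hc h hca) (hω.ne hcb)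
      have := posRank_lt_posRank hc h7
      exact ⟨h7, by omega⟩
  obtain ⟨hoo, hc, hle⟩ := hsep
  have hoq : q o < q o' := (posRank_lt_iff hq ha.best.1 hb.best.1).1 hoo
  have hne : o ≠ o' := fun e => by simp [e] at hoq
  refine ⟨hne, Finset.mem_erase.2 ⟨hab, ha.mem⟩, ha.best.erase hne, ?_, ?_⟩
  · rwa [posRank_erase_of_le hoq.le]
  · intro c hcS hca t ht
    obtain ⟨hcb, hcS⟩ := Finset.mem_erase.1 hcS
    obtain ⟨hto, htO⟩ := Finset.mem_erase.1 ht.1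
    obtain ⟨h1, h2⟩ := hc c hcS hca hcb
    rw [posRank_erase_of_le h1.le]
    rcases lt_or_gt_of_ne (hq.ne hto) with h | h
    · rw [posRank_erase_of_le h.le]
      rcases ht.of_erase hsp hq with h3 | h3
      · exact ha.lt c hcS hca t h3
      · omega
    · have := posRank_erase_of_lt hb.best.1 h
      have := posRank_lt_posRank hb.best.1 h
      omega

theorem CrawlRun.card_eq {x : Fin n → Fin n} (h : CrawlRun rk ω q S O x) : S.card = O.card := by
  induction h with
  | nil => rfl
  | cons h t ih =>
    have := Finset.card_erase_add_one h.mem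
    have := Finset.card_erase_add_one h.best.1
    omega

/-- A first step of the crawler can be extracted from any run of the mirror crawler. -/
theorem CrawlRun.erase_of_step (hrk : ∀ i, (rk i).Injective) (hsp : NoInteriorWorst rk q)
    (hω : ω.Injective) (hq : q.Injective) {y : Fin n → Fin n}
    (hy : CrawlRun rk (fun i => (ω i).rev) (fun i => (q i).rev) S O y) {a o : Fin n}
    (ha : CrawlStep rk ω q S O a o) :
    y a = o ∧
      CrawlRun rk (fun i => (ω i).rev) (fun i => (q i).rev) (S.erase a) (O.erase o) y := by
  induction hy with
  | nil => simpa using ha.mem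
  | @cons S O y b hb t ih =>
    have hcard := (CrawlRun.cons hb t).card_eq
    by_cases hab : a = b
    · subst hab
      have := hb.best.eq (hrk a) ha.best
      exact ⟨this, this ▸ t⟩
    · obtain ⟨hne, ha'⟩ := ha.erase_of_rev hsp hω hq hcard hab hb
      obtain ⟨h1, h2⟩ := ih ha'
      refine ⟨h1, .cons (a := b) ?_ ?_⟩
      · exact (hb.erase_of_rev hsp.rev (Fin.rev_injective.comp hω) (Fin.rev_injective.comp hq)
          hcard (Ne.symm hab) (by simpa only [Function.comp_def, Fin.rev_rev] using ha)).2
      · rwa [Finset.erase_right_comm, Finset.erase_right_comm (a := o)]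

theorem CrawlRun.eq_of_rev (hrk : ∀ i, (rk i).Injective) (hsp : NoInteriorWorst rk q)
    (hω : ω.Injective) (hq : q.Injective) {x y : Fin n → Fin n} (hx : CrawlRun rk ω q S O x)
    (hy : CrawlRun rk (fun i => (ω i).rev) (fun i => (q i).rev) S O y) :
    ∀ i ∈ S, x i = y i := by
  induction hx with
  | nil => simp
  | @cons S O x a h t ih =>
    obtain ⟨h1, h2⟩ := hy.erase_of_step hrk hsp hω hq h
    intro i hi
    by_cases hia : i = a
    · rw [hia, h1]
    · exact ih h2 i (Finset.mem_erase.2 ⟨hia, hi⟩)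

theorem CrawlRun.congr {x y : Fin n → Fin n} (h : CrawlRun rk ω q S O x)
    (hxy : ∀ i ∈ S, x i = y i) : CrawlRun rk ω q S O y := by
  induction h with
  | nil => exact .nil y
  | @cons S O x a h t ih =>
    have ha := hxy a h.mem
    rw [ha] at h ih
    exact .cons h (ih fun i hi => hxy i (Finset.mem_of_mem_erase hi))

theorem isBest_image_rev {r : Fin n → Fin n} {o : Fin n} :
    IsBest r (O.image Fin.rev) o ↔ IsBest (fun x => r x.rev) O o.rev := by
  refine and_congr (by simp [Fin.rev_eq_iff]) ?_
  rw [Finset.forall_mem_image]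
  simp

theorem posRank_image_rev (o : Fin n) :
    posRank q (O.image Fin.rev) o = posRank (fun x => q x.rev) O o.rev := by
  simp only [posRank, Finset.filter_image, Fin.rev_rev]
  exact Finset.card_image_of_injective _ Fin.rev_injective

theorem CrawlRun.image_rev {x : Fin n → Fin n}
    (h : CrawlRun (fun j o => rk j o.rev) ω (fun o => q o.rev) S O x) :
    CrawlRun rk ω q S (O.image Fin.rev) fun i => (x i).rev := by
  induction h with
  | nil => exact .nil _
  | @cons S O x a h t ih =>
    refine .cons (a := a) ⟨h.mem, ?_, ?_, fun c hc hca t ht => ?_⟩ ?_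
    · simpa [isBest_image_rev] using h.best
    · simpa [posRank_image_rev] using h.le
    · simpa [posRank_image_rev] using h.lt c hc hca _ (isBest_image_rev.1 ht)
    · rwa [← Finset.image_erase Fin.rev_injective]

section Lists

theorem posRank_getElem {f : Fin n → Fin n} {L : List (Fin n)}
    (hL : L.Pairwise fun x y => f x < f y) {j : ℕ} (hj : j < L.length) :
    posRank f L.toFinset L[j] = j := by
  have hnd : L.Nodup := hL.imp fun h e => by simp [e] at h
  have h : L.toFinset.filter (fun y => f y < f L[j]) = (L.take j).toFinset := by
    rw [List.pairwise_iff_getElem] at hL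
    ext z
    simp only [Finset.mem_filter, List.mem_toFinset, List.mem_take_iff_getElem]
    constructor
    · rintro ⟨hz, hlt⟩
      obtain ⟨i, hi, rfl⟩ := List.getElem_of_mem hz
      refine ⟨i, lt_min ?_ hi, rfl⟩
      by_contra! hji
      rcases hji.eq_or_lt with rfl | hji
      · exact lt_irrefl _ hlt
      · exact (hL j i hj hi hji).not_gt hlt
    · rintro ⟨i, hi, rfl⟩
      exact ⟨List.getElem_mem _, hL i j _ hj (by omega)⟩
  rw [posRank, h, List.toFinset_card_of_nodup (hnd.sublist (List.take_sublist _ _)),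
    List.length_take, min_eq_left hj.le]

theorem findIdx2_lt (rk : Fin n → Fin n → Fin n) :
    ∀ A B : List (Fin n), A.length = B.length → A ≠ [] → findIdx2 rk A B < A.length
  | [], _, _, h => absurd rfl h
  | [_], [], hl, _ => by simp at hl
  | [_], [_], _, _ => by simp [findIdx2]
  | _ :: _ :: _, [], hl, _ => by simp at hl
  | _ :: _ :: _, [_], hl, _ => by simp at hl
  | [_], _ :: _ :: _, hl, _ => by simp at hl
  | a :: a' :: A, o1 :: o2 :: B, hl, _ => by
    have := findIdx2_lt rk (a' :: A) (o2 :: B) (by simpa using hl) (by simp)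
    rw [findIdx2]
    split_ifs
    · simp
    · simpa using this

theorem le_of_lt_findIdx2 (rk : Fin n → Fin n → Fin n) :
    ∀ (A B : List (Fin n)) (i : ℕ) (hA : i < A.length) (hB : i + 1 < B.length),
      i < findIdx2 rk A B → rk A[i] B[i + 1] ≤ rk A[i] B[i]
  | [], _, _, hA, _, _ => by simp at hA
  | _ :: _, [], _, _, hB, _ => by simp at hB
  | _ :: _, [_], _, _, hB, _ => by simp at hB
  | a :: A, o1 :: o2 :: B, i, hA, hB, h => by
    rw [findIdx2] at h
    split_ifs at h with hlt
    · simp at h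
    · cases i with
      | zero => simpa using hlt
      | succ i =>
        exact le_of_lt_findIdx2 rk A (o2 :: B) i (by simpa using hA) (by simpa using hB) (by omega)

theorem lt_of_eq_findIdx2 (rk : Fin n → Fin n → Fin n) :
    ∀ (A B : List (Fin n)) (t : ℕ) (hA : t < A.length) (hB : t + 1 < B.length),
      t = findIdx2 rk A B → rk A[t] B[t] < rk A[t] B[t + 1]
  | [], _, _, hA, _, _ => by simp at hA
  | _ :: _, [], _, _, hB, _ => by simp at hB
  | _ :: _, [_], _, _, hB, _ => by simp at hB
  | a :: A, o1 :: o2 :: B, t, hA, hB, h => by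
    rw [findIdx2] at h
    split_ifs at h with hlt
    · subst h
      exact hlt
    · subst h
      exact lt_of_eq_findIdx2 rk A (o2 :: B) _ (by simpa using hA) (by simpa using hB) rfl

/-- The agent selected by `findIdx2`, together with his best object, is a crawler step. -/
theorem crawlStep_findIdx2 (hrk : ∀ i, (rk i).Injective) (hsp : NoInteriorWorst rk id)
    {A B : List (Fin n)} (hA : A.Pairwise fun a b => ω a < ω b) (hB : B.Pairwise (· < ·))
    (hl : A.length = B.length) (ht : findIdx2 rk A B < A.length) {o : Fin n}
    (ho : IsBest (rk A[findIdx2 rk A B]) B.toFinset o) :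
    CrawlStep rk ω id A.toFinset B.toFinset A[findIdx2 rk A B] o := by
  have hBi := List.pairwise_iff_getElem.1 hB
  refine ⟨by simp, ho, ?_, ?_⟩
  · obtain ⟨j, hj, rfl⟩ := List.getElem_of_mem (List.mem_toFinset.1 ho.1)
    rw [posRank_getElem hA, posRank_getElem (f := id) hB]
    by_contra! htj
    have h1 := lt_of_eq_findIdx2 rk A B _ ht (by omega) rfl
    have h2 := ho.2 B[findIdx2 rk A B] (by simp)
    rcases Nat.eq_or_lt_of_le (Nat.succ_le_of_lt htj) with h | h
    · subst h
      exact h1.not_ge h2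
    · have h3 := ho.2 B[findIdx2 rk A B + 1] (by simp)
      rcases hsp A[findIdx2 rk A B] _ _ _ (hBi _ _ (by omega) (by omega) (Nat.lt_succ_self _))
        (hBi _ _ (by omega) hj h) with h4 | h4
      · exact h4.not_gt h1
      · exact h4.not_ge h3
  · intro c hc hca T hT
    obtain ⟨i, hi, rfl⟩ := List.getElem_of_mem (List.mem_toFinset.1 hc)
    obtain ⟨j, hj, rfl⟩ := List.getElem_of_mem (List.mem_toFinset.1 hT.1)
    have hit : i < findIdx2 rk A B := by
      have := posRank_lt_posRank hc hca
      rwa [posRank_getElem hA, posRank_getElem hA] at this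
    rw [posRank_getElem hA, posRank_getElem (f := id) hB]
    by_contra! hji
    have h1 := le_of_lt_findIdx2 rk A B i hi (by omega) hit
    have h2 := hBi i (i + 1) (by omega) (by omega) (Nat.lt_succ_self _)
    rcases hji.eq_or_lt with h | h
    · subst h
      exact h2.ne (hrk _ (le_antisymm (hT.2 _ (by simp)) h1))
    · rcases hsp A[i] _ _ _ (hBi _ _ hj (by omega) h) h2 with h3 | h3
      · exact h3.not_ge (hT.2 _ (by simp))
      · exact h3.not_ge h1

theorem toFinset_eraseIdx {L : List (Fin n)} (hL : L.Nodup) {t : ℕ} (ht : t < L.length) :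
    (L.eraseIdx t).toFinset = L.toFinset.erase L[t] := by
  rw [← hL.erase_getElem t ht]
  ext z
  simp [hL.mem_erase_iff]

theorem crawlRun_crawlAux (hrk : ∀ i, (rk i).Injective) (hsp : NoInteriorWorst rk id)
    (d : Fin n → Fin n) (A B : List (Fin n)) (hA : A.Pairwise fun a b => ω a < ω b)
    (hB : B.Pairwise (· < ·)) (hl : A.length = B.length) :
    CrawlRun rk ω id A.toFinset B.toFinset
      fun i => ((crawlAux rk A.length A B).lookup i).getD (d i) := by
  induction hm : A.length generalizing A B with
  | zero =>
    obtain rfl := List.length_eq_zero_iff.1 hm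
    obtain rfl := List.length_eq_zero_iff.1 (hl.symm.trans hm)
    exact .nil _
  | succ m ih =>
    have hAne : A ≠ [] := by rintro rfl; simp at hm
    have hBne : B ≠ [] := by rintro rfl; simp_all
    have ht := findIdx2_lt rk A B hl hAne
    have hAnd : A.Nodup := hA.imp fun h e => by simp [e] at h
    have hBnd : B.Nodup := hB.imp fun h => h.ne
    obtain ⟨o, ho⟩ : ∃ o, B.argmin (rk A[findIdx2 rk A B]) = some o :=
      Option.ne_none_iff_exists'.1 (List.argmin_eq_none.not.2 hBne)
    have hoB : o ∈ B := List.argmin_mem ho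
    have hbest : IsBest (rk A[findIdx2 rk A B]) B.toFinset o :=
      ⟨by simpa using hoB, fun z hz => List.le_of_mem_argmin (by simpa using hz) ho⟩
    have hrun : crawlAux rk (m + 1) A B = (A[findIdx2 rk A B], o) ::
        crawlAux rk m (A.eraseIdx (findIdx2 rk A B)) (B.erase o) := by
      obtain ⟨a0, A', rfl⟩ := List.exists_cons_of_ne_nil hAne
      obtain ⟨o0, B', rfl⟩ := List.exists_cons_of_ne_nil hBne
      simp only [crawlAux, List.getD_eq_getElem _ _ ht, ho, Option.getD_some]
    have hstep := crawlStep_findIdx2 hrk hsp hA hB hl ht hbest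
    have hrec := ih (A.eraseIdx (findIdx2 rk A B)) (B.erase o)
      (hA.sublist (List.eraseIdx_sublist _ _)) (hB.sublist List.erase_sublist)
      (by rw [List.length_eraseIdx_of_lt ht, List.length_erase_of_mem hoB, hl])
      (by rw [List.length_eraseIdx_of_lt ht, hm]; rfl)
    have hB_erase : B.toFinset.erase o = (B.erase o).toFinset := by
      ext z
      simp [hBnd.mem_erase_iff]
    rw [toFinset_eraseIdx hAnd ht, ← hB_erase] at hrec
    rw [hrun]
    refine .cons (a := A[findIdx2 rk A B]) (by simpa using hstep) ?_
    simp only [List.lookup_cons_self, Option.getD_some]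
    refine hrec.congr fun i hi => ?_
    rw [List.lookup_cons, beq_false_of_ne (Finset.mem_erase.1 hi).1]

end Lists

theorem ownersList_eq_map (ω : Equiv.Perm (Fin n)) :
    ownersList ω = (List.finRange n).map ω.symm := by
  rw [ownersList, ← List.filterMap_eq_map]
  congr 1
  funext o
  cases h : (List.finRange n).find? fun a => ω a == o with
  | none =>
    have := List.find?_eq_none.1 h (ω.symm o) (List.mem_finRange _)
    simp at this
  | some a =>
    have := List.find?_some h
    simp only [beq_iff_eq] at this
    subst this
    exact congrArg some (ω.symm_apply_apply a).symm

theorem crawlRun_CRfun (hrk : ∀ i, (rk i).Injective) (hsp : NoInteriorWorst rk id)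
    (ω : Equiv.Perm (Fin n)) :
    CrawlRun rk ω id Finset.univ Finset.univ (CRfun rk ω) := by
  have h := crawlRun_crawlAux (ω := ω) hrk hsp ω (ownersList ω) (List.finRange n)
    (by simpa [ownersList_eq_map, List.pairwise_map] using List.pairwise_lt_finRange n)
    (List.pairwise_lt_finRange n) (by simp [ownersList_eq_map])
  have h1 : (ownersList ω).toFinset = Finset.univ := by
    ext i
    simpa [ownersList_eq_map] using ⟨ω i, ω.symm_apply_apply i⟩
  have h2 : (ownersList ω).length = n := by simp [ownersList_eq_map]
  rw [h1, h2, List.toFinset_finRange] at h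
  exact h

theorem SinglePeaked.noInteriorWorst {P : Fin n → Equiv.Perm (Fin n)} (hP : SinglePeaked P) :
    NoInteriorWorst (fun j => ⇑(P j)) id := by
  intro i x y z hxy hyz
  obtain ⟨p, hp⟩ := hP i
  rcases le_total y p with h | h
  · exact .inl (hp y x (.inl ⟨hxy, h⟩))
  · exact .inr (hp y z (.inr ⟨h, hyz⟩))

end Crawler

/-- For every single-peaked preference profile `P` and every endowment
profile `ω`, the ascending crawler and the descending crawler select the same
allocation: `ACR(P,ω) = DCR(P,ω)`. -/
theorem ascending_crawler_eq_descending_crawler {n : ℕ} (hn : 1 ≤ n)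
    (P : Fin n → Equiv.Perm (Fin n)) (hP : SinglePeaked P) (ω : Equiv.Perm (Fin n)) :
    CRfun (fun j => ⇑(P j)) ⇑ω = DCRfun (fun j => ⇑(P j)) ⇑ω := by
  have hsp := hP.noInteriorWorst
  have hx := crawlRun_CRfun (fun i => (P i).injective) hsp ω
  have hy := crawlRun_CRfun (rk := fun j o => P j o.rev)
    (fun i => (P i).injective.comp Fin.rev_injective)
    (fun i x y z hxy hyz =>
      hsp.rev i _ _ _ (by simpa using hxy) (by simpa using hyz)) (ω.trans Fin.revPerm)
  have hy' : CrawlRun (fun j => ⇑(P j)) (fun i => (ω i).rev) (fun i => (id i).rev)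
      Finset.univ (Finset.univ.image Fin.rev) (DCRfun (fun j => ⇑(P j)) ω) :=
    CrawlRun.image_rev (q := fun i => (id i).rev) (by
      simp only [id, Fin.rev_rev]
      exact hy)
  rw [Finset.image_univ_of_surjective Fin.rev_surjective] at hy'
  funext i
  exact hx.eq_of_rev (fun i => (P i).injective) hsp ω.injective Function.injective_id hy' i
    (Finset.mem_univ i)
end

section
/- For every preference profile P that is single-peaked with respect to ≺, every endowment profile ω, and every agent i such that DCR_i(P,ω) ≺ ω_i, one has DCR_i(P,ω) = ACR_i(P,ω). -/
/-! The crawler is a strategy for a rewriting system on partial allocations, whose moves are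
mutually beneficial swaps of adjacent remaining objects and departures of agents who own their
favourite remaining object. Under single-peaked preferences this system is confluent, and it is
invariant under reversal of the order on objects, so the ascending and descending crawlers agree. -/

/-- One move on a state `(σ, S)`, where `σ` is the current ownership and `S` is the set of
remaining agents. -/
inductive TradeStep {n : ℕ} (P : Fin n → Equiv.Perm (Fin n)) :
    Equiv.Perm (Fin n) × Finset (Fin n) → Equiv.Perm (Fin n) × Finset (Fin n) → Prop
  | swap {σ : Equiv.Perm (Fin n)} {S : Finset (Fin n)} {i j : Fin n} (hi : i ∈ S) (hj : j ∈ S)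
      (hlt : σ i < σ j) (hadj : ∀ k ∈ S, ¬(σ i < σ k ∧ σ k < σ j))
      (hPi : P i (σ j) < P i (σ i)) (hPj : P j (σ i) < P j (σ j)) :
      TradeStep P (σ, S) (σ * Equiv.swap i j, S)
  | leave {σ : Equiv.Perm (Fin n)} {S : Finset (Fin n)} {i : Fin n} (hi : i ∈ S)
      (htop : ∀ k ∈ S, P i (σ i) ≤ P i (σ k)) :
      TradeStep P (σ, S) (σ, S.erase i)

namespace TradeStep

open Relation

variable {n : ℕ} {P : Fin n → Equiv.Perm (Fin n)}

lemma swap_apply_mem {S : Finset (Fin n)} {i j k : Fin n} (hi : i ∈ S) (hj : j ∈ S)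
    (hk : k ∈ S) : Equiv.swap i j k ∈ S := by
  rw [Equiv.swap_apply_def]
  split_ifs <;> assumption

/-- A swap and a departure available at the same state commute. -/
lemma swap_leave_comm {σ : Equiv.Perm (Fin n)} {S : Finset (Fin n)} {i j a : Fin n}
    (hi : i ∈ S) (hj : j ∈ S) (hlt : σ i < σ j) (hadj : ∀ k ∈ S, ¬(σ i < σ k ∧ σ k < σ j))
    (hPi : P i (σ j) < P i (σ i)) (hPj : P j (σ i) < P j (σ j))
    (ha : a ∈ S) (htop : ∀ k ∈ S, P a (σ a) ≤ P a (σ k)) :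
    TradeStep P (σ * Equiv.swap i j, S) (σ * Equiv.swap i j, S.erase a) ∧
      TradeStep P (σ, S.erase a) (σ * Equiv.swap i j, S.erase a) := by
  have hai : a ≠ i := by
    rintro rfl
    exact absurd hPi (not_lt.2 (htop _ hj))
  have haj : a ≠ j := by
    rintro rfl
    exact absurd hPj (not_lt.2 (htop _ hi))
  refine ⟨leave ha fun k hk => ?_, swap (Finset.mem_erase.2 ⟨hai.symm, hi⟩)
    (Finset.mem_erase.2 ⟨haj.symm, hj⟩) hlt
    (fun k hk => hadj k (Finset.mem_of_mem_erase hk)) hPi hPj⟩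
  simpa [Equiv.swap_apply_of_ne_of_ne hai haj] using htop _ (swap_apply_mem hi hj hk)

/-- A swap remains available after a disjoint swap. -/
lemma swap_after_swap {σ : Equiv.Perm (Fin n)} {S : Finset (Fin n)} {i j k l : Fin n}
    (hi : i ∈ S) (hj : j ∈ S) (hk : k ∈ S) (hl : l ∈ S)
    (hik : i ≠ k) (hil : i ≠ l) (hjk : j ≠ k) (hjl : j ≠ l)
    (hlt : σ k < σ l) (hadj : ∀ m ∈ S, ¬(σ k < σ m ∧ σ m < σ l))
    (hPk : P k (σ l) < P k (σ k)) (hPl : P l (σ k) < P l (σ l)) :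
    TradeStep P (σ * Equiv.swap i j, S) (σ * Equiv.swap i j * Equiv.swap k l, S) := by
  have ek : (σ * Equiv.swap i j) k = σ k := by
    simp [Equiv.swap_apply_of_ne_of_ne hik.symm hjk.symm]
  have el : (σ * Equiv.swap i j) l = σ l := by
    simp [Equiv.swap_apply_of_ne_of_ne hil.symm hjl.symm]
  refine swap hk hl ?_ ?_ ?_ ?_ <;> rw [ek, el]
  · exact hlt
  · exact fun m hm => hadj _ (swap_apply_mem hi hj hm)
  · exact hPk
  · exact hPl

lemma not_prefers_both_sides (hP : SinglePeaked P) {i o₁ o₂ o₃ : Fin n} (h₁ : o₁ < o₂)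
    (h₂ : o₂ < o₃) (h₃ : P i o₁ < P i o₂) : ¬ P i o₃ < P i o₂ := by
  obtain ⟨p, hp⟩ := hP i
  intro h₄
  rcases le_total o₂ p with h | h
  · exact lt_asymm h₃ (hp _ _ (.inl ⟨h₁, h⟩))
  · exact lt_asymm h₄ (hp _ _ (.inr ⟨h, h₂⟩))

lemma diamond (hP : SinglePeaked P) {a b c : Equiv.Perm (Fin n) × Finset (Fin n)}
    (hab : TradeStep P a b) (hac : TradeStep P a c) :
    ∃ d, ReflGen (TradeStep P) b d ∧ ReflTransGen (TradeStep P) c d := by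
  cases hab with
  | @swap σ S i j hi hj hlt hadj hPi hPj =>
    cases hac with
    | @swap _ _ k l hk hl hlt' hadj' hPk hPl =>
      have hil : i ≠ l := by
        rintro rfl
        exact not_prefers_both_sides hP hlt' hlt hPl hPi
      have hjk : j ≠ k := by
        rintro rfl
        exact not_prefers_both_sides hP hlt hlt' hPj hPk
      by_cases hik : i = k
      · subst hik
        have : j = l := σ.injective <| le_antisymm
          (not_lt.1 fun h => hadj l hl ⟨hlt', h⟩) (not_lt.1 fun h => hadj' j hj ⟨hlt, h⟩)
        subst this
        exact ⟨_, .refl, .refl⟩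
      by_cases hjl : j = l
      · subst hjl
        exact absurd (σ.injective <| le_antisymm (not_lt.1 fun h => hadj' i hi ⟨h, hlt⟩)
          (not_lt.1 fun h => hadj k hk ⟨h, hlt'⟩)) hik
      have hcomm : Equiv.swap i j * Equiv.swap k l = Equiv.swap k l * Equiv.swap i j :=
        (Equiv.Perm.disjoint_swap_swap (by
          have := ne_of_apply_ne σ hlt.ne
          have := ne_of_apply_ne σ hlt'.ne
          simp_all)).commute
      refine ⟨(σ * Equiv.swap i j * Equiv.swap k l, S),
        .single (swap_after_swap hi hj hk hl hik hil hjk hjl hlt' hadj' hPk hPl), ?_⟩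
      rw [mul_assoc, hcomm, ← mul_assoc]
      exact .single (swap_after_swap hk hl hi hj (Ne.symm hik) hjk.symm hil.symm (Ne.symm hjl)
        hlt hadj hPi hPj)
    | leave ha htop =>
      have h := swap_leave_comm hi hj hlt hadj hPi hPj ha htop
      exact ⟨_, .single h.1, .single h.2⟩
  | @leave σ S i hi htop =>
    cases hac with
    | swap hk hl hlt hadj hPk hPl =>
      have h := swap_leave_comm hk hl hlt hadj hPk hPl hi htop
      exact ⟨_, .single h.2, .single h.1⟩
    | @leave _ _ j hj htop' =>
      by_cases hij : i = j
      · subst hij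
        exact ⟨_, .refl, .refl⟩
      refine ⟨(σ, (S.erase i).erase j), .single (leave (Finset.mem_erase.2 ⟨Ne.symm hij, hj⟩)
        fun k hk => htop' k (Finset.mem_of_mem_erase hk)), ?_⟩
      rw [Finset.erase_right_comm]
      exact .single (leave (Finset.mem_erase.2 ⟨hij, hi⟩)
        fun k hk => htop k (Finset.mem_of_mem_erase hk))

lemma eq_of_reflTransGen_empty {σ : Equiv.Perm (Fin n)}
    {d : Equiv.Perm (Fin n) × Finset (Fin n)}
    (h : ReflTransGen (TradeStep P) (σ, ∅) d) : d = (σ, ∅) := by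
  rcases h.cases_head with h | ⟨c, hc, -⟩
  · exact h.symm
  · cases hc <;> simp_all

/-- All complete runs from the same state lead to the same allocation. -/
lemma final_unique (hP : SinglePeaked P) {a : Equiv.Perm (Fin n) × Finset (Fin n)}
    {σ τ : Equiv.Perm (Fin n)} (hσ : ReflTransGen (TradeStep P) a (σ, ∅))
    (hτ : ReflTransGen (TradeStep P) a (τ, ∅)) : σ = τ := by
  obtain ⟨d, h₁, h₂⟩ := church_rosser (fun _ _ _ => diamond hP) hσ hτ
  exact congrArg Prod.fst ((eq_of_reflTransGen_empty h₁).symm.trans (eq_of_reflTransGen_empty h₂))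

/-- Moves are mirrored by reversing the order on objects. -/
lemma rev {a b : Equiv.Perm (Fin n) × Finset (Fin n)}
    (h : TradeStep (fun j => P j * Fin.revPerm) a b) :
    TradeStep P (Fin.revPerm * a.1, a.2) (Fin.revPerm * b.1, b.2) := by
  cases h with
  | @swap σ S i j hi hj hlt hadj hPi hPj =>
    rw [Equiv.swap_comm]
    refine swap hj hi (by simpa using hlt) (fun k hk hkk => hadj k hk ?_) hPj hPi
    simpa [and_comm] using hkk
  | leave hi htop => exact leave hi htop

/-- An agent who prefers to move left past agents who all prefer to move right can do so
by successive swaps. -/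
lemma bubble {a : Fin n} {A : List (Fin n)} {S : Finset (Fin n)} (B : List (Fin n)) :
    ∀ (C : List (Fin n)) (σ : Equiv.Perm (Fin n)), (∀ k, k ∈ S ↔ k ∈ A ++ B ++ a :: C) →
    ((A ++ B ++ a :: C).map σ).Pairwise (· < ·) →
    (B ++ [a]).IsChain (fun x y => P x (σ y) < P x (σ x) ∧ P a (σ x) < P a (σ y)) →
    ∃ τ : Equiv.Perm (Fin n), ReflTransGen (TradeStep P) (σ, S) (τ, S) ∧
      (A ++ a :: (B ++ C)).map τ = (A ++ B ++ a :: C).map σ ∧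
      ∀ k, k ∉ S → τ k = σ k := by
  induction B using List.reverseRecOn with
  | nil => exact fun C σ _ _ _ => ⟨σ, .refl, by simp, fun _ _ => rfl⟩
  | append_singleton B b ih =>
    intro C σ hS hsort hchain
    have hnd : (A ++ (B ++ [b]) ++ a :: C).Nodup :=
      List.Nodup.of_map σ (hsort.imp fun h => h.ne)
    have hb : b ∈ S := (hS b).2 (by simp)
    have ha : a ∈ S := (hS a).2 (by simp)
    have hfix : ∀ k, k ≠ b → k ≠ a → (σ * Equiv.swap b a) k = σ k := fun k h₁ h₂ => by
      simp [Equiv.swap_apply_of_ne_of_ne h₁ h₂]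
    have hfixl : ∀ l : List (Fin n), b ∉ l → a ∉ l → l.map (σ * Equiv.swap b a) = l.map σ :=
      fun l h₁ h₂ => List.map_congr_left fun k hk =>
        hfix k (fun h => h₁ (h ▸ hk)) (fun h => h₂ (h ▸ hk))
    have hmap : (A ++ B ++ a :: b :: C).map (σ * Equiv.swap b a) =
        (A ++ (B ++ [b]) ++ a :: C).map σ := by
      have h1 := hfixl A (by grind) (by grind)
      have h2 := hfixl B (by grind) (by grind)
      have h3 := hfixl C (by grind) (by grind)
      simp only [List.map_append, List.map_cons, h1, h2, h3]
      simp
    have hpair := hsort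
    simp only [List.map_append, List.map_cons, List.map_nil, List.pairwise_append,
      List.pairwise_cons] at hpair
    have hlt : σ b < σ a := by grind
    have hlast : P b (σ a) < P b (σ b) ∧ P a (σ b) < P a (σ a) := by
      rw [List.append_assoc, List.isChain_append] at hchain
      simpa using hchain.2.1
    have hstep : TradeStep P (σ, S) (σ * Equiv.swap b a, S) := by
      refine swap hb ha hlt (fun k hk hkk => ?_) hlast.1 hlast.2
      have hk' := (hS k).1 hk
      simp only [List.mem_append, List.mem_cons, List.not_mem_nil, or_false] at hk'
      grind
    obtain ⟨τ, h₁, h₂, h₃⟩ := ih (b :: C) (σ * Equiv.swap b a) (by simp [hS]; grind)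
      (by rw [hmap]; exact hsort) (by
        have hc := hchain.left_of_append
        have hB : b ∉ B ∧ a ∉ B := by grind
        rw [List.isChain_append] at hc ⊢
        refine ⟨hc.1.imp_of_mem_imp fun x y hx hy h => ?_, by simp, fun x hx y hy => ?_⟩
        · rwa [hfix x (by grind) (by grind), hfix y (by grind) (by grind)]
        · have hx' := List.mem_of_mem_getLast? hx
          have := hc.2.2 x hx b (by simp)
          obtain rfl : a = y := by simpa using hy
          rw [hfix x (by grind) (by grind)]
          simpa using this)
    refine ⟨τ, .head hstep h₁, ?_, fun k hk => ?_⟩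
    · rw [← hmap, ← h₂]; simp
    · rw [h₃ k hk, hfix k (by grind) (by grind)]

end TradeStep

section Crawler

open Relation

variable {n : ℕ} {P : Fin n → Equiv.Perm (Fin n)}

/-- `findIdx2` locates the first agent who does not prefer the next object. -/
lemma findIdx2_spec (σ : Equiv.Perm (Fin n)) : ∀ L : List (Fin n), L ≠ [] → L.Nodup →
    ∃ l₁ a l₂, L = l₁ ++ a :: l₂ ∧ findIdx2 (fun j => ⇑(P j)) L (L.map σ) = l₁.length ∧
      (l₁ ++ [a]).IsChain (fun x y => P x (σ y) < P x (σ x)) ∧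
      ∀ c ∈ l₂.head?, P a (σ a) < P a (σ c)
  | [], h, _ => absurd rfl h
  | [a], _, _ => ⟨[], a, [], by simp [findIdx2]⟩
  | a :: b :: L, _, hnd => by
    by_cases h : P a (σ a) < P a (σ b)
    · exact ⟨[], a, b :: L, by simp [findIdx2, h]⟩
    obtain ⟨l₁, c, l₂, h₁, h₂, h₃, h₄⟩ := findIdx2_spec σ (b :: L) (by simp) hnd.of_cons
    have hab : P a (σ b) < P a (σ a) := lt_of_le_of_ne (not_lt.1 h) fun h => by
      have := σ.injective ((P a).injective h)
      simp_all
    refine ⟨a :: l₁, c, l₂, by simp [h₁], ?_, ?_, h₄⟩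
    · simp only [List.map_cons] at h₂
      simp [findIdx2, h, h₂]
    · rw [List.cons_append, List.isChain_cons]
      refine ⟨fun y hy => ?_, h₃⟩
      have : b = y := by
        cases l₁ <;> simp_all
      exact this ▸ hab

/-- The choice of the first agent not wanting to move right is realised by moves. -/
lemma crawl_step (hP : SinglePeaked P) (σ : Equiv.Perm (Fin n)) {L : List (Fin n)}
    {a₀ o₀ : Fin n} (hL : L ≠ []) (hsort : (L.map σ).Pairwise (· < ·)) :
    ∃ (τ : Equiv.Perm (Fin n)) (a : Fin n), a ∈ L ∧
      L.getD (findIdx2 (fun j => ⇑(P j)) L (L.map σ)) a₀ = a ∧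
      ((L.map σ).argmin (P a)).getD o₀ = τ a ∧
      (L.eraseIdx (findIdx2 (fun j => ⇑(P j)) L (L.map σ))).map τ = (L.map σ).erase (τ a) ∧
      (L.eraseIdx (findIdx2 (fun j => ⇑(P j)) L (L.map σ))).toFinset = L.toFinset.erase a ∧
      (∀ k, k ∉ L → τ k = σ k) ∧
      ReflTransGen (TradeStep P) (σ, L.toFinset) (τ, L.toFinset.erase a) := by
  have hnd : L.Nodup := List.Nodup.of_map σ (hsort.imp fun h => h.ne)
  obtain ⟨l₁, a, l₂, rfl, hidx, hchain, hnext⟩ := findIdx2_spec (P := P) σ L hL hnd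
  obtain ⟨o, ho⟩ : ∃ o, ((l₁ ++ a :: l₂).map σ).argmin (P a) = some o := by
    rw [← Option.ne_none_iff_exists']
    simp [List.argmin_eq_none]
  have hmem := List.argmin_mem ho
  have hmin : ∀ s ∈ l₁ ++ a :: l₂, P a o ≤ P a (σ s) := fun s hs =>
    List.le_of_mem_argmin (List.mem_map_of_mem hs) ho
  obtain ⟨s, hs, rfl⟩ := List.mem_map.1 hmem
  obtain ⟨p, hp⟩ := hP a
  have hpair := hsort
  simp only [List.map_append, List.map_cons, List.pairwise_append, List.pairwise_cons] at hpair
  have hs' : s ∉ l₂ := by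
    intro hsl
    obtain ⟨c, l₃, rfl⟩ := List.exists_cons_of_ne_nil (List.ne_nil_of_mem hsl)
    have hac := hnext c (by simp)
    have hlt : σ a < σ c := by grind
    have hpc : p < σ c := by
      by_contra! h
      exact lt_asymm hac (hp _ _ (.inl ⟨hlt, h⟩))
    have hcs : P a (σ c) ≤ P a (σ s) := by
      rcases List.mem_cons.1 hsl with rfl | h
      · rfl
      · have := (List.pairwise_cons.1 hpair.2.1.2).1 (σ s) (List.mem_map_of_mem h)
        exact (hp _ _ (.inr ⟨hpc.le, this⟩)).le
    exact absurd (hmin a (by simp)) (not_le.2 (hac.trans_le hcs))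
  obtain ⟨A, B, D, rfl, hB⟩ : ∃ A B D, l₁ = A ++ B ∧ B ++ [a] = s :: D := by
    rcases List.mem_append.1 hs with h | h
    · obtain ⟨A, D, rfl⟩ := List.append_of_mem h
      exact ⟨A, s :: D, D ++ [a], rfl, rfl⟩
    · obtain rfl : s = a := by simpa [hs'] using h
      exact ⟨l₁, [], [], by simp, rfl⟩
  have hBsort : ((B ++ [a]).map σ).Pairwise (· < ·) := by
    refine hsort.sublist (List.Sublist.map σ ?_)
    simp
  have hBP : (B ++ [a]).Pairwise fun x y => P a (σ x) < P a (σ y) := by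
    rw [List.pairwise_map] at hBsort
    rw [hB] at hBsort ⊢
    have hsub : ∀ x ∈ s :: D, x ∈ A ++ B ++ a :: l₂ := by
      intro x hx
      rw [← hB] at hx
      simp only [List.mem_append, List.mem_cons, List.not_mem_nil, or_false] at hx ⊢
      tauto
    rw [List.pairwise_cons] at hBsort ⊢
    refine ⟨fun x hx => lt_of_le_of_ne (hmin x (hsub x (by simp [hx]))) fun h =>
      (hBsort.1 x hx).ne ((P a).injective h), hBsort.2.imp_of_mem fun {x y} hx _ hxy => ?_⟩
    refine hp _ _ (.inr ⟨?_, hxy⟩)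
    by_contra! h
    exact absurd (hmin x (hsub x (by simp [hx])))
      (not_le.2 (hp _ _ (.inl ⟨hBsort.1 x hx, h.le⟩)))
  obtain ⟨τ, hτ, hmap, hout⟩ := TradeStep.bubble (P := P) (a := a) (A := A)
    (S := (A ++ B ++ a :: l₂).toFinset) B l₂ σ (fun k => List.mem_toFinset) hsort (by
      rw [List.append_assoc] at hchain
      have h₁ := hchain.right_of_append
      have h₂ := hBP.isChain
      rw [List.isChain_iff_getElem] at h₁ h₂ ⊢
      exact fun i hi => ⟨h₁ i hi, h₂ i hi⟩)
  have hτa : τ a = σ s := by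
    have e : A ++ B ++ a :: l₂ = A ++ s :: (D ++ l₂) := by
      rw [List.append_assoc, ← List.singleton_append, ← List.append_assoc B, hB]; simp
    rw [e, List.map_append, List.map_append] at hmap
    have := (List.append_inj hmap (by simp)).2
    simp only [List.map_cons, List.cons.injEq] at this
    exact this.1
  have herase : (A ++ B ++ a :: l₂).eraseIdx (A ++ B).length = A ++ B ++ l₂ := by
    rw [List.eraseIdx_append_of_length_le le_rfl]
    simp
  refine ⟨τ, a, by simp, ?_, ?_, ?_, ?_, fun k hk => hout k (mt List.mem_toFinset.1 hk),
    hτ.tail (.leave (by simp) fun k hk => ?_)⟩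
  · rw [hidx]; simp
  · rw [ho, hτa]; rfl
  · rw [hidx, herase, ← hmap]
    have hA : τ a ∉ A.map τ := by
      have : a ∉ A := by grind
      simpa using this
    rw [List.map_append (l₁ := A) (l₂ := a :: (B ++ l₂)), List.erase_append_right _ hA]
    simp
  · rw [hidx, herase]
    ext k
    simp only [List.mem_toFinset, Finset.mem_erase, List.mem_append, List.mem_cons]
    grind
  · have hk' : τ k ∈ (A ++ a :: (B ++ l₂)).map τ := by
      refine List.mem_map_of_mem ?_
      simp only [List.mem_toFinset, List.mem_append, List.mem_cons] at hk ⊢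
      tauto
    rw [hmap] at hk'
    obtain ⟨m, hm, hmk⟩ := List.mem_map.1 hk'
    rw [hτa, ← hmk]
    exact hmin m hm

lemma crawlAux_spec (hP : SinglePeaked P) : ∀ (fuel : ℕ) (L : List (Fin n))
    (σ : Equiv.Perm (Fin n)), L.length ≤ fuel → (L.map σ).Pairwise (· < ·) →
    ∃ τ : Equiv.Perm (Fin n), ReflTransGen (TradeStep P) (σ, L.toFinset) (τ, ∅) ∧
      (∀ i ∈ L, (crawlAux (fun j => ⇑(P j)) fuel L (L.map σ)).lookup i = some (τ i)) ∧
      ∀ i, i ∉ L → τ i = σ i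
  | fuel, [], σ, _, _ => ⟨σ, by simpa using .refl, by simp, fun _ _ => rfl⟩
  | 0, _ :: _, _, h, _ => by simp at h
  | fuel + 1, a₀ :: L, σ, hlen, hsort => by
    obtain ⟨τ, a, ha, hget, hmin, hmap, hfin, hout, hsteps⟩ :=
      crawl_step hP σ (a₀ := a₀) (o₀ := σ a₀) (by simp) hsort
    set t := findIdx2 (fun j => ⇑(P j)) (a₀ :: L) ((a₀ :: L).map σ)
    have hmem : ∀ k, k ∈ (a₀ :: L).eraseIdx t ↔ k ≠ a ∧ k ∈ a₀ :: L := fun k => by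
      rw [← List.mem_toFinset, hfin, Finset.mem_erase, List.mem_toFinset]
    have hlen' : ((a₀ :: L).eraseIdx t).length ≤ fuel := by
      have hnd : (a₀ :: L).Nodup := List.Nodup.of_map σ (hsort.imp fun h => h.ne)
      have hnd' := hnd.sublist (List.eraseIdx_sublist (a₀ :: L) t)
      rw [← List.toFinset_card_of_nodup hnd', hfin,
        Finset.card_erase_of_mem (List.mem_toFinset.2 ha), List.toFinset_card_of_nodup hnd]
      omega
    obtain ⟨ρ, hρ, hlook, hρout⟩ := crawlAux_spec hP fuel ((a₀ :: L).eraseIdx t) τ hlen'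
      (by rw [hmap]; exact hsort.sublist List.erase_sublist)
    have hunfold : crawlAux (fun j => ⇑(P j)) (fuel + 1) (a₀ :: L) ((a₀ :: L).map σ) =
        (a, τ a) :: crawlAux (fun j => ⇑(P j)) fuel ((a₀ :: L).eraseIdx t)
          (((a₀ :: L).eraseIdx t).map τ) := by
      rw [hmap, ← hmin, ← hget]
      rfl
    refine ⟨ρ, hsteps.trans (hfin ▸ hρ), fun i hi => ?_, fun i hi => ?_⟩
    · rw [hunfold]
      by_cases hia : i = a
      · subst hia
        simp [hρout i (by simp [hmem])]
      · rw [List.lookup_cons, beq_false_of_ne hia]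
        exact hlook i ((hmem i).2 ⟨hia, hi⟩)
    · rw [hρout i (by simp only [hmem]; tauto), hout i hi]

lemma ownersList_eq (ω : Equiv.Perm (Fin n)) :
    ownersList ⇑ω = (List.finRange n).map ω.symm := by
  rw [ownersList, ← List.filterMap_eq_map]
  congr 1
  funext o
  have hsome : ((List.finRange n).find? fun a => ω a == o).isSome := by
    rw [List.find?_isSome]
    exact ⟨ω.symm o, List.mem_finRange _, by simp⟩
  obtain ⟨a, ha⟩ := Option.isSome_iff_exists.1 hsome
  have := List.find?_some ha
  rw [ha, Function.comp_apply, ← beq_iff_eq.1 this, Equiv.symm_apply_apply]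

/-- The crawler allocation is reached from the endowments by a complete run of moves. -/
lemma exists_run_CRfun (hP : SinglePeaked P) (ω : Equiv.Perm (Fin n)) :
    ∃ τ : Equiv.Perm (Fin n), ReflTransGen (TradeStep P) (ω, Finset.univ) (τ, ∅) ∧
      ∀ i, CRfun (fun j => ⇑(P j)) ⇑ω i = τ i := by
  have hmap : (ownersList ⇑ω).map ω = List.finRange n := by
    simp [ownersList_eq, Function.comp_def]
  have hall : ∀ i, i ∈ ownersList ⇑ω := fun i => by
    rw [ownersList_eq]
    exact List.mem_map.2 ⟨ω i, List.mem_finRange _, by simp⟩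
  obtain ⟨τ, h₁, h₂, -⟩ := crawlAux_spec hP n (ownersList ⇑ω) ω (by simp [ownersList_eq])
    (by rw [hmap]; exact List.pairwise_lt_finRange n)
  refine ⟨τ, ?_, fun i => ?_⟩
  · rwa [show (ownersList ⇑ω).toFinset = Finset.univ by ext; simp [hall]] at h₁
  · have := h₂ i (hall i)
    rw [hmap] at this
    simp [CRfun, this]

lemma SinglePeaked.rev (hP : SinglePeaked P) : SinglePeaked fun j => P j * Fin.revPerm := by
  intro i
  obtain ⟨p, hp⟩ := hP i
  refine ⟨p.rev, fun o o' h => hp o.rev o'.rev ?_⟩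
  rcases h with ⟨h₁, h₂⟩ | ⟨h₁, h₂⟩
  · exact .inr ⟨Fin.le_rev_iff.1 h₂, Fin.rev_lt_rev.2 h₁⟩
  · exact .inl ⟨Fin.rev_lt_rev.2 h₂, Fin.rev_le_iff.1 h₁⟩

/-- The ascending and descending crawlers coincide on single-peaked profiles. -/
theorem DCRfun_eq_CRfun (hP : SinglePeaked P) (ω : Equiv.Perm (Fin n)) (i : Fin n) :
    DCRfun (fun j => ⇑(P j)) ⇑ω i = CRfun (fun j => ⇑(P j)) ⇑ω i := by
  obtain ⟨τ, hτ, hCR⟩ := exists_run_CRfun hP ω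
  obtain ⟨ρ, hρ, hDCR⟩ := exists_run_CRfun hP.rev (Fin.revPerm * ω)
  have hlift := ReflTransGen.lift (p := TradeStep P)
    (fun a : Equiv.Perm (Fin n) × Finset (Fin n) => (Fin.revPerm * a.1, a.2))
    (fun _ _ => TradeStep.rev (P := P)) _ _ hρ
  have hinv : Fin.revPerm * (Fin.revPerm * ω) = ω := by
    ext; simp
  simp only [Function.onFun, hinv] at hlift
  rw [hCR, ← TradeStep.final_unique hP hlift hτ]
  exact congrArg Fin.rev (hDCR i)

end Crawler

/-- if `DCR_i(P,ω) ≺ ω_i` then `DCR_i(P,ω) = ACR_i(P,ω)`. -/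
theorem dcr_eq_acr_of_lt_endowment {n : ℕ} (hn : 1 ≤ n)
    (P : Fin n → Equiv.Perm (Fin n)) (hP : SinglePeaked P) (ω : Equiv.Perm (Fin n))
    (i : Fin n) (h : DCRfun (fun j => ⇑(P j)) ⇑ω i < ω i) :
    DCRfun (fun j => ⇑(P j)) ⇑ω i = CRfun (fun j => ⇑(P j)) ⇑ω i := by
  exact DCRfun_eq_CRfun hP ω i
end

section
/- For every preference profile P that is single-peaked with respect to ≺, every endowment profile ω, and every agent i, one has ACR_i(P,ω) = ω_i if and only if DCR_i(P,ω) = ω_i. -/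
/-- Delete the `t`-th entry of a sequence. -/
def del {α : Type*} (t : ℕ) (f : ℕ → α) : ℕ → α := fun j => if j < t then f j else f (j + 1)

theorem del_of_lt {α : Type*} {t j : ℕ} (f : ℕ → α) (h : j < t) : del t f j = f j := if_pos h

theorem del_of_le {α : Type*} {t j : ℕ} (f : ℕ → α) (h : t ≤ j) : del t f j = f (j + 1) :=
  if_neg (not_lt.2 h)

theorem del_comm {α : Type*} {t u : ℕ} (f : ℕ → α) (h : t ≤ u) :
    del u (del t f) = del t (del (u + 1) f) := by
  funext j
  unfold del
  split_ifs <;> first | rfl | omega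

section Crawler

variable {ι α κ : Type*} [LinearOrder α] [LinearOrder κ]

/-- `AscRun rk x m A O`: the ascending crawler, run on the agents `A 0, …, A (m - 1)` owning the
objects `O 0, …, O (m - 1)`, assigns each of these agents `a` the object `x a`. -/
inductive AscRun (rk : ι → α → κ) (x : ι → α) : ℕ → (ℕ → ι) → (ℕ → α) → Prop
  | nil (A : ℕ → ι) (O : ℕ → α) : AscRun rk x 0 A O
  | step (m : ℕ) (A : ℕ → ι) (O : ℕ → α) (t s : ℕ) (ht : t ≤ m) (hs : s ≤ m)
      (hpass : ∀ j < t, rk (A j) (O (j + 1)) < rk (A j) (O j))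
      (hkeep : t < m → rk (A t) (O t) < rk (A t) (O (t + 1)))
      (htop : ∀ r ≤ m, rk (A t) (O s) ≤ rk (A t) (O r))
      (hx : x (A t) = O s) (h : AscRun rk x m (del t A) (del s O)) : AscRun rk x (m + 1) A O

/-- The mirror image of `AscRun`, for the descending crawler. -/
inductive DescRun (rk : ι → α → κ) (x : ι → α) : ℕ → (ℕ → ι) → (ℕ → α) → Prop
  | nil (A : ℕ → ι) (O : ℕ → α) : DescRun rk x 0 A O
  | step (m : ℕ) (A : ℕ → ι) (O : ℕ → α) (t s : ℕ) (ht : t ≤ m) (hs : s ≤ m)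
      (hpass : ∀ j, t ≤ j → j < m → rk (A (j + 1)) (O j) < rk (A (j + 1)) (O (j + 1)))
      (hkeep : ∀ u, t = u + 1 → rk (A t) (O t) < rk (A t) (O u))
      (htop : ∀ r ≤ m, rk (A t) (O s) ≤ rk (A t) (O r))
      (hx : x (A t) = O s) (h : DescRun rk x m (del t A) (del s O)) : DescRun rk x (m + 1) A O

/-- No object is worse than both an object to its left and an object to its right. -/
def NoValley (r : α → κ) : Prop := ∀ x y z, x < y → y < z → r y < r x ∨ r y < r z

theorem NoValley.lt_of_lt {r : α → κ} (h : NoValley r) {x y z : α} (hxy : x < y) (hyz : y < z)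
    (hzy : r z < r y) : r y < r x :=
  (h x y z hxy hyz).resolve_right hzy.asymm

theorem NoValley.lt_of_lt' {r : α → κ} (h : NoValley r) {x y z : α} (hxy : x < y) (hyz : y < z)
    (hzy : r x < r y) : r y < r z :=
  (h x y z hxy hyz).resolve_left hzy.asymm

/-- The first `m` entries of `O` are strictly increasing. -/
def IncrUpTo (m : ℕ) (O : ℕ → α) : Prop := ∀ i j, i < j → j < m → O i < O j

theorem IncrUpTo.del {m : ℕ} {O : ℕ → α} (h : IncrUpTo (m + 1) O) (s : ℕ) :
    IncrUpTo m (del s O) := by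
  intro i j hij hj
  unfold _root_.del
  split_ifs <;> apply h <;> omega

/-- If the agent prefers `O (j + 1)` to `O j`, his best object is to the right of `O j`. -/
theorem lt_of_prefers_succ {r : α → κ} (hr : NoValley r) {m j s : ℕ} {O : ℕ → α}
    (hO : IncrUpTo m O) (hj : j + 1 < m) (h : r (O (j + 1)) < r (O j))
    (htop : ∀ i < m, r (O s) ≤ r (O i)) : j < s := by
  by_contra! hs
  rcases hs.eq_or_lt with rfl | hs
  · exact absurd (htop _ hj) (not_le.2 h)
  · exact absurd (hr.lt_of_lt (hO s j hs (by omega)) (hO j (j + 1) (by omega) hj) h)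
      (not_lt.2 (htop j (by omega)))

/-- If the agent prefers `O t` to `O (t + 1)`, his best object is weakly to the left of `O t`. -/
theorem le_of_prefers {r : α → κ} (hr : NoValley r) {m t s : ℕ} {O : ℕ → α}
    (hO : IncrUpTo m O) (hs : s < m) (h : t + 1 < m → r (O t) < r (O (t + 1)))
    (htop : ∀ i < m, r (O s) ≤ r (O i)) : s ≤ t := by
  by_contra! hts
  have h1 := h (by omega)
  rcases (Nat.succ_le_of_lt hts).eq_or_lt with e | hlt
  · subst e
    exact absurd (htop t (by omega)) (not_le.2 h1)
  · exact absurd (hr.lt_of_lt' (hO t (t + 1) (by omega) (by omega)) (hO _ s hlt hs) h1)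
      (not_lt.2 (htop _ (by omega)))

/-- Suppose the best object of the agent at `t` is at `s ≤ t`, and every agent from `s` to `t - 1`
prefers the object on his right to his own. Then the descending crawler assigns the agent at `t`
that object, and is not affected by making this assignment first. -/
theorem DescRun.assign {rk : ι → α → κ} {y : ι → α} (hV : ∀ a, NoValley (rk a))
    (hinj : ∀ a, Function.Injective (rk a)) {m : ℕ} {A : ℕ → ι} {O : ℕ → α}
    (hD : DescRun rk y m A O) (hO : IncrUpTo m O) (t s : ℕ) (ht : t < m) (hst : s ≤ t)
    (htop : ∀ r < m, rk (A t) (O s) ≤ rk (A t) (O r))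
    (hchain : ∀ j, s ≤ j → j < t → rk (A j) (O (j + 1)) < rk (A j) (O j)) :
    y (A t) = O s ∧ DescRun rk y (m - 1) (del t A) (del s O) := by
  induction hD generalizing t s with
  | nil A O => omega
  | step m A O u v hu hv hpass hkeep htopu hx hrec ih =>
    have hO' := hO.del v
    have htops : ∀ r ≤ m, r ≠ s → rk (A t) (O s) < rk (A t) (O r) := by
      intro r hr hrs
      refine lt_of_le_of_ne (htop r (by omega)) fun e => ?_
      have e := hinj _ e
      rcases lt_or_gt_of_ne hrs with h | h
      · exact (hO r s h (by omega)).ne e.symm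
      · exact (hO s r h (by omega)).ne e
    have htopv : ∀ r < m + 1, rk (A u) (O v) ≤ rk (A u) (O r) := fun r hr => htopu r (by omega)
    rcases lt_trichotomy u t with hut | hut | hut
    · -- the agent just left of `t` is next, and crosses `t`
      have hlt : s < t := by
        by_contra! hle
        obtain rfl : s = t := by omega
        obtain ⟨t', rfl⟩ : ∃ t', s = t' + 1 := ⟨s - 1, by omega⟩
        exact absurd (hpass t' (by omega) (by omega)) (htops t' (by omega) (by omega)).asymm
      obtain ⟨t', rfl⟩ : ∃ t', t = t' + 1 := ⟨t - 1, by omega⟩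
      have hw := hchain t' (by omega) (by omega)
      obtain rfl : u = t' := by
        by_contra hne
        obtain ⟨w, rfl⟩ : ∃ w, t' = w + 1 := ⟨t' - 1, by omega⟩
        exact absurd (hpass w (by omega) (by omega))
          ((hV _).lt_of_lt (hO w _ (by omega) (by omega)) (hO _ _ (by omega) ht) hw).asymm
      have huv : u < v := lt_of_prefers_succ (hV _) hO ht hw htopv
      obtain ⟨v', rfl⟩ : ∃ v', v = v' + 1 := ⟨v - 1, by omega⟩
      have hi := ih hO' u s (by omega) (by omega) (fun r hr => by
          rw [del_of_le A le_rfl, del_of_lt O (by omega)]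
          unfold del; split_ifs <;> apply htop <;> omega)
        (fun j hj hju => by
          rw [del_of_lt A hju, del_of_lt O (by omega), del_of_lt O (by omega)]
          exact hchain j hj (by omega))
      rw [del_of_le A le_rfl, del_of_lt O (by omega)] at hi
      refine ⟨hi.1, ?_⟩
      obtain ⟨m, rfl⟩ : ∃ m', m = m' + 1 := ⟨m - 1, by omega⟩
      refine DescRun.step m _ _ u v' (by omega) (by omega) (fun j hj hjm => ?_) (fun w hw' => ?_)
        (fun r hr => ?_) ?_ ?_
      · rw [del_of_le A (by omega), del_of_le O (by omega), del_of_le O (by omega)]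
        exact hpass (j + 1) (by omega) (by omega)
      · rw [del_of_lt A (by omega), del_of_le O (by omega)]
        unfold del
        split_ifs with hws
        · exact hw.trans ((hV _).lt_of_lt (hO w u (by omega) (by omega))
            (hO _ _ (by omega) ht) hw)
        · rw [← hw']; exact hw
      · rw [del_of_lt A (by omega), del_of_le O (by omega)]
        unfold del; split_ifs <;> apply htopv <;> omega
      · rw [del_of_lt A (by omega), del_of_le O (by omega)]
        exact hx
      · rw [del_comm O (by omega), ← del_comm A le_rfl]
        exact hi.2
    · -- the agent at `t` is next
      subst hut
      obtain rfl : v = s := by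
        by_contra hne
        exact absurd (htops v hv hne) (not_lt.2 (htopv s (by omega)))
      exact ⟨hx, hrec⟩
    · -- an agent to the right of `t` is next
      obtain ⟨u', rfl⟩ : ∃ u', u = u' + 1 := ⟨u - 1, by omega⟩
      have hw := hkeep u' rfl
      have huv : u' < v := lt_of_prefers_succ (hV _) hO (by omega) hw htopv
      obtain ⟨v', rfl⟩ : ∃ v', v = v' + 1 := ⟨v - 1, by omega⟩
      have hi := ih hO' t s (by omega) (by omega) (fun r hr => by
          rw [del_of_lt A hut, del_of_lt O (by omega)]
          unfold del; split_ifs <;> apply htop <;> omega)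
        (fun j hj hju => by
          rw [del_of_lt A (by omega), del_of_lt O (by omega), del_of_lt O (by omega)]
          exact hchain j hj (by omega))
      rw [del_of_lt A hut, del_of_lt O (by omega)] at hi
      refine ⟨hi.1, ?_⟩
      obtain ⟨m, rfl⟩ : ∃ m', m = m' + 1 := ⟨m - 1, by omega⟩
      refine DescRun.step m _ _ u' v' (by omega) (by omega) (fun j hj hjm => ?_) (fun w hw' => ?_)
        (fun r hr => ?_) ?_ ?_
      · rw [del_of_le A (by omega), del_of_le O (by omega), del_of_le O (by omega)]
        exact hpass (j + 1) (by omega) (by omega)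
      · rw [del_of_le A (by omega), del_of_le O (by omega)]
        unfold del
        split_ifs with hws
        · exact hw.trans ((hV _).lt_of_lt (hO w u' (by omega) (by omega))
            (hO _ _ (by omega) (by omega)) hw)
        · rw [← hw']; exact hw
      · rw [del_of_le A (by omega), del_of_le O (by omega)]
        unfold del; split_ifs <;> apply htopv <;> omega
      · rw [del_of_le A (by omega), del_of_le O (by omega)]
        exact hx
      · rw [del_comm O (by omega), del_comm A (by omega)]
        exact hi.2

/-- On single-peaked preferences the ascending and the descending crawler coincide. -/
theorem AscRun.eq_of_descRun {rk : ι → α → κ} {x y : ι → α} (hV : ∀ a, NoValley (rk a))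
    (hinj : ∀ a, Function.Injective (rk a)) {m : ℕ} {A : ℕ → ι} {O : ℕ → α}
    (hA : AscRun rk x m A O) (hD : DescRun rk y m A O) (hO : IncrUpTo m O) :
    ∀ j < m, x (A j) = y (A j) := by
  induction hA with
  | nil A O => intro j hj; omega
  | step m A O t s ht hs hpass hkeep htop hx h ih =>
    have htop' : ∀ r < m + 1, rk (A t) (O s) ≤ rk (A t) (O r) := fun r hr => htop r (by omega)
    have hst : s ≤ t := le_of_prefers (hV _) hO (by omega) (fun h => hkeep (by omega)) htop'
    obtain ⟨hy, hD'⟩ := hD.assign hV hinj hO t s (by omega) hst htop' fun j _ hj => hpass j hj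
    have hi := ih hD' (hO.del s)
    intro j hj
    rcases lt_trichotomy j t with hjt | rfl | hjt
    · simpa [del_of_lt A hjt] using hi j (by omega)
    · rw [hx, hy]
    · obtain ⟨j, rfl⟩ : ∃ j', j = j' + 1 := ⟨j - 1, by omega⟩
      simpa [del_of_le A (show t ≤ j by omega)] using hi j (by omega)

/-- The descending crawler is the ascending crawler in the reversed order. -/
theorem AscRun.descRun {β : Type*} {rk : ι → α → κ} {rk' : ι → β → κ} {x : ι → α} {x' : ι → β}
    {f : β → α} (hrk : ∀ a o, rk' a o = rk a (f o)) (hx : ∀ a, x a = f (x' a))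
    {m : ℕ} {A' : ℕ → ι} {O' : ℕ → β} (h : AscRun rk' x' m A' O') (A : ℕ → ι) (O : ℕ → α)
    (hA : ∀ i j, i + j + 1 = m → A i = A' j) (hO : ∀ i j, i + j + 1 = m → O i = f (O' j)) :
    DescRun rk x m A O := by
  induction h generalizing A O with
  | nil => exact .nil A O
  | step m A' O' t s ht hs hpass hkeep htop hx' h ih =>
    have hAt := hA (m - t) t (by omega)
    refine .step m A O (m - t) (m - s) (by omega) (by omega) (fun j hj hjm => ?_)
      (fun u hu => ?_) (fun r hr => ?_) ?_ (ih _ _ (fun i j hij => ?_) fun i j hij => ?_)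
    · have := hpass (m - (j + 1)) (by omega)
      rw [hrk, hrk] at this
      rwa [hA (j + 1) (m - (j + 1)) (by omega), hO (j + 1) (m - (j + 1)) (by omega),
        hO j (m - (j + 1) + 1) (by omega)]
    · have := hkeep (by omega)
      rw [hrk, hrk] at this
      rwa [hAt, hO (m - t) t (by omega), hO u (t + 1) (by omega)]
    · have := htop (m - r) (by omega)
      rw [hrk, hrk] at this
      rwa [hAt, hO (m - s) s (by omega), hO r (m - r) (by omega)]
    · rw [hAt, hx, hx', hO (m - s) s (by omega)]
    · unfold del
      split_ifs <;> first | omega | (apply hA; omega)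
    · unfold del
      split_ifs <;> first | omega | (apply hO; omega)

end Crawler

theorem getD_eraseIdx {α : Type*} (l : List α) (t : ℕ) (d : α) :
    (fun j => (l.eraseIdx t).getD j d) = del t fun j => l.getD j d := by
  funext j
  simp only [List.getD_eq_getElem?_getD, List.getElem?_eraseIdx, del]
  split_ifs <;> rfl

theorem findIdx2_spec_s3 {n : ℕ} (rk : Fin n → Fin n → Fin n) (hinj : ∀ a, Function.Injective (rk a))
    (d d' : Fin n) (A O : List (Fin n)) (m : ℕ) (hA : A.length = m + 1) (hO : O.length = m + 1)
    (hnd : O.Nodup) :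
    findIdx2 rk A O ≤ m ∧
      (∀ j < findIdx2 rk A O,
        rk (A.getD j d) (O.getD (j + 1) d') < rk (A.getD j d) (O.getD j d')) ∧
      (findIdx2 rk A O < m → rk (A.getD (findIdx2 rk A O) d) (O.getD (findIdx2 rk A O) d') <
        rk (A.getD (findIdx2 rk A O) d) (O.getD (findIdx2 rk A O + 1) d')) := by
  induction m generalizing A O with
  | zero =>
    obtain ⟨a, rfl⟩ := List.length_eq_one_iff.1 hA
    obtain ⟨o, rfl⟩ := List.length_eq_one_iff.1 hO
    simp [findIdx2]
  | succ m ih =>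
    match A, O, hA, hO, hnd with
    | a :: as, o :: o' :: os, hA, hO, hnd =>
      unfold findIdx2
      split_ifs with hlt
      · simpa using hlt
      · obtain ⟨h1, h2, h3⟩ := ih as (o' :: os) (by simpa using hA) (by simpa using hO)
          (List.nodup_cons.1 hnd).2
        refine ⟨by omega, fun j hj => ?_, fun hj => ?_⟩
        · cases j with
          | zero =>
            have hne : o' ≠ o := by rintro rfl; simp at hnd
            exact lt_of_le_of_ne (not_lt.1 hlt) fun e => hne (hinj a e)
          | succ j => simpa using h2 j (by omega)
        · simpa using h3 (by omega)

theorem crawlAux_ascRun {n : ℕ} (rk : Fin n → Fin n → Fin n)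
    (hinj : ∀ a, Function.Injective (rk a)) (w x : Fin n → Fin n) (d d' : Fin n) (m : ℕ)
    (A O : List (Fin n)) (hA : A.length = m) (hO : O.length = m) (hndA : A.Nodup)
    (hndO : O.Nodup) (hx : ∀ a ∈ A, ((crawlAux rk m A O).lookup a).getD (w a) = x a) :
    AscRun rk x m (fun j => A.getD j d) (fun j => O.getD j d') := by
  induction m generalizing A O with
  | zero => exact .nil _ _
  | succ m ih =>
    match A, O, hA, hO, hndA, hndO, hx with
    | a0 :: as, o0 :: os, hA, hO, hndA, hndO, hx =>
      rw [crawlAux] at hx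
      obtain ⟨ht, hpass, hkeep⟩ := findIdx2_spec_s3 rk hinj d d' _ _ m hA hO hndO
      generalize hAdef : a0 :: as = A at *
      generalize hOdef : o0 :: os = O at *
      generalize findIdx2 rk A O = t at *
      have htA : t < A.length := by omega
      have htd : A.getD t a0 = A[t] := List.getD_eq_getElem _ _ htA
      have htd' : A.getD t d = A[t] := List.getD_eq_getElem _ _ htA
      obtain ⟨o, ho⟩ : ∃ o, O.argmin (rk A[t]) = some o := by
        rw [← Option.ne_none_iff_exists', Ne, List.argmin_eq_none, ← hOdef]
        simp
      obtain ⟨s, hs, rfl⟩ := List.mem_iff_getElem.1 (List.argmin_mem ho)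
      have hsd : O.getD s d' = O[s] := List.getD_eq_getElem _ _ hs
      simp only [htd, ho, Option.getD_some] at hx
      refine .step m _ _ t s ht (by omega) hpass hkeep (fun r hr => ?_) ?_ ?_
      · simp only [htd', hsd]
        rw [List.getD_eq_getElem _ _ (show r < O.length by omega)]
        exact List.le_of_mem_argmin (List.getElem_mem _) ho
      · simp only [htd', hsd]
        rw [← hx _ (List.getElem_mem htA)]
        simp
      · rw [← getD_eraseIdx, ← getD_eraseIdx]
        refine ih _ _ (by rw [List.length_eraseIdx_of_lt htA]; omega)
          (by rw [List.length_eraseIdx_of_lt hs]; omega) (hndA.eraseIdx t) (hndO.eraseIdx s)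
          fun a ha => ?_
        have hne : a ≠ A[t] := by
          rintro rfl
          rw [← hndA.erase_getElem t htA] at ha
          exact hndA.not_mem_erase ha
        rw [← hx a (List.mem_of_mem_eraseIdx ha), List.lookup_cons, hndO.erase_getElem s hs,
          beq_false_of_ne hne]

theorem ownersList_perm {n : ℕ} (ω : Equiv.Perm (Fin n)) :
    ownersList ω = (List.finRange n).map ω.symm := by
  rw [ownersList, ← List.filterMap_eq_map]
  refine List.filterMap_congr fun o _ => ?_
  cases h : (List.finRange n).find? fun a => ω a == o with
  | none => exact absurd (List.find?_eq_none.1 h (ω.symm o) (List.mem_finRange _)) (by simp)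
  | some a =>
    have ha : ω a = o := by simpa using List.find?_some h
    simp [← ha]

theorem CRfun_ascRun {n : ℕ} (rk : Fin n → Fin n → Fin n)
    (hinj : ∀ a, Function.Injective (rk a)) (ω : Equiv.Perm (Fin n)) (d d' : Fin n) :
    AscRun rk (CRfun rk ω) n (fun j => ((List.finRange n).map ω.symm).getD j d)
      (fun j => (List.finRange n).getD j d') := by
  refine crawlAux_ascRun rk hinj ω _ d d' n _ _ (by simp) (by simp)
    ((List.nodup_finRange n).map ω.symm.injective) (List.nodup_finRange n) fun a _ => ?_
  rw [CRfun, ownersList_perm]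

theorem SinglePeaked.noValley {n : ℕ} {P : Fin n → Equiv.Perm (Fin n)} (hP : SinglePeaked P)
    (i : Fin n) : NoValley (P i) := by
  intro x y z hxy hyz
  obtain ⟨p, hp⟩ := hP i
  rcases le_total y p with h | h
  · exact .inl (hp y x (.inl ⟨hxy, h⟩))
  · exact .inr (hp y z (.inr ⟨h, hyz⟩))

theorem CRfun_eq_DCRfun {n : ℕ} (P : Fin n → Equiv.Perm (Fin n)) (hP : SinglePeaked P)
    (ω : Equiv.Perm (Fin n)) (i : Fin n) :
    CRfun (fun j => ⇑(P j)) ⇑ω i = DCRfun (fun j => ⇑(P j)) ⇑ω i := by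
  have hA := CRfun_ascRun (fun j => ⇑(P j)) (fun j => (P j).injective) ω i i
  have hR := CRfun_ascRun (fun j o => P j o.rev)
    (fun j => (P j).injective.comp Fin.rev_injective) (ω.trans Fin.revPerm) i i
  have hD := hR.descRun (rk := fun j => ⇑(P j)) (x := DCRfun (fun j => ⇑(P j)) ⇑ω) (f := Fin.rev)
    (fun _ _ => rfl) (fun _ => rfl) (fun j => ((List.finRange n).map ω.symm).getD j i)
    (fun j => (List.finRange n).getD j i) (fun k j h => ?_) fun k j h => ?_
  · have := hA.eq_of_descRun hP.noValley (fun j => (P j).injective) hD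
      (fun k j hkj hj => ?_) (ω i) (ω i).isLt
    · simpa using this
    · beta_reduce
      rw [List.getD_eq_getElem _ _ (by simp; omega), List.getD_eq_getElem _ _ (by simp; omega)]
      simpa using hkj
  · rw [List.getD_eq_getElem _ _ (by simp; omega), List.getD_eq_getElem _ _ (by simp; omega)]
    simp [Fin.ext_iff]
    omega
  · rw [List.getD_eq_getElem _ _ (by simp; omega), List.getD_eq_getElem _ _ (by simp; omega)]
    simp [Fin.ext_iff]
    omega

/-- `ACR_i(P,ω) = ω_i` iff `DCR_i(P,ω) = ω_i`. -/
theorem acr_eq_endowment_iff_dcr_eq_endowment {n : ℕ} (hn : 1 ≤ n)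
    (P : Fin n → Equiv.Perm (Fin n)) (hP : SinglePeaked P) (ω : Equiv.Perm (Fin n))
    (i : Fin n) :
    CRfun (fun j => ⇑(P j)) ⇑ω i = ω i ↔ DCRfun (fun j => ⇑(P j)) ⇑ω i = ω i := by
  rw [CRfun_eq_DCRfun P hP ω i]
end
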